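/- Let D be a separable, unital, strongly self-absorbing C*-algebra. Then the unitaries implementing the approximately inner flip on D ⊗ D may be chosen to represent 0 in K₁(D ⊗ D) ≅ K₁(D); that is, there is a sequence of unitaries (vₖ) in D ⊗ D with [vₖ] = 0 in K₁(D ⊗ D) for all k and ‖vₖ*(a ⊗ b)vₖ − b ⊗ a‖ → 0 for all a, b ∈ D. In particular, if D is K₁-injective, the unitaries may be chosen to be homotopic to the unit 1_{D⊗D}. -/

import Mathlib

open scoped MultiplierAlgebra TensorProduct
open Filter Topology

noncomputable section

universe u v w x

/-- Approximate unitary equivalence of two maps `φ ψ : A → B`, witnessed by a sequence of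
unitaries in the multiplier algebra `𝓜(ℂ, B)` (in which `B` embeds canonically). -/
def ApproxUnitaryEquiv {A : Type u} {B : Type v} [NonUnitalCStarAlgebra B]
    (φ ψ : A → B) : Prop :=
  ∃ v : ℕ → 𝓜(ℂ, B), (∀ n, v n ∈ unitary 𝓜(ℂ, B)) ∧
    ∀ a : A, Tendsto
      (fun n => ‖star (v n) * (φ a : 𝓜(ℂ, B)) * v n - (ψ a : 𝓜(ℂ, B))‖)
      atTop (𝓝 (0 : ℝ))

/-- Data exhibiting `T` as a C*-tensor product of `A` and `B`: a bilinear, multiplicative,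
star-preserving, cross-normed map `A × B → T` with dense span. -/
structure CStarTensor (A : Type u) (B : Type v) (T : Type w) [NonUnitalCStarAlgebra A]
    [NonUnitalCStarAlgebra B] [NonUnitalCStarAlgebra T] where
  tmul : A → B → T
  add_left : ∀ a a' b, tmul (a + a') b = tmul a b + tmul a' b
  add_right : ∀ a b b', tmul a (b + b') = tmul a b + tmul a b'
  smul_left : ∀ (c : ℂ) a b, tmul (c • a) b = c • tmul a b
  smul_right : ∀ (c : ℂ) a b, tmul a (c • b) = c • tmul a b
  mul_tmul : ∀ a a' b b', tmul a b * tmul a' b' = tmul (a * a') (b * b')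
  star_tmul : ∀ a b, star (tmul a b) = tmul (star a) (star b)
  norm_tmul : ∀ a b, ‖tmul a b‖ = ‖a‖ * ‖b‖
  dense_span : Dense ((Submodule.span ℂ {t : T | ∃ a b, tmul a b = t} : Submodule ℂ T) : Set T)

/-- Data exhibiting `T` as *the minimal (spatial) tensor product* of `A` and `B`: a C*-tensor
product which is dominated by every other C*-tensor product of `A` and `B` (i.e., it carries
the smallest C*-norm). -/
structure MinTensor (A : Type u) (B : Type v) (T : Type w) [NonUnitalCStarAlgebra A]
    [NonUnitalCStarAlgebra B] [NonUnitalCStarAlgebra T] extends CStarTensor A B T where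
  minimal : ∀ (T' : Type (max u v)) [NonUnitalCStarAlgebra T'] (h : CStarTensor A B T'),
    ∃ π : T' →⋆ₙₐ[ℂ] T, ∀ a b, π (h.tmul a b) = tmul a b

/-- The first-factor unital embedding `d ↦ d ⊗ 1`. -/
def MinTensor.fst {D : Type u} {E : Type v} {T : Type w} [CStarAlgebra D] [CStarAlgebra E]
    [CStarAlgebra T] (h : MinTensor D E T) : D → T := fun d => h.tmul d 1

/-- The second-factor unital embedding `d ↦ 1 ⊗ d`. -/
def MinTensor.snd {D : Type u} {E : Type v} {T : Type w} [CStarAlgebra D] [CStarAlgebra E]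
    [CStarAlgebra T] (h : MinTensor D E T) : E → T := fun d => h.tmul 1 d

/-- A unital C*-algebra `D` has *approximately inner half flip* (with respect to a
realization `T` of the minimal tensor product `D ⊗ D`) if the two factor embeddings
`id_D ⊗ 1_D` and `1_D ⊗ id_D` of `D` into `D ⊗ D` are approximately unitarily equivalent. -/
def HasApproxInnerHalfFlip {D : Type u} {T : Type w} [CStarAlgebra D] [CStarAlgebra T]
    (h : MinTensor D D T) : Prop :=
  ApproxUnitaryEquiv h.fst h.snd

/-- A unital C*-algebra `D` has *approximately inner flip* (with respect to a realization
`T` of `D ⊗ D`) if the flip automorphism `σ_D : a ⊗ b ↦ b ⊗ a` of `D ⊗ D` is approximately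
unitarily equivalent to the identity map. -/
def HasApproxInnerFlip {D : Type u} {T : Type w} [CStarAlgebra D] [CStarAlgebra T]
    (h : MinTensor D D T) : Prop :=
  ∃ σ : T ≃⋆ₐ[ℂ] T, (∀ a b, σ (h.tmul a b) = h.tmul b a) ∧
    ApproxUnitaryEquiv (⇑σ) (id : T → T)

/-- A unital C*-algebra `D ≇ ℂ` is *strongly self-absorbing* (with respect to a realization
`T` of the minimal tensor product `D ⊗ D`) if there is an isomorphism `φ : D → D ⊗ D` which
is approximately unitarily equivalent to `id_D ⊗ 1_D`. -/
def IsStronglySelfAbsorbing {D : Type u} {T : Type w} [CStarAlgebra D] [CStarAlgebra T]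
    (h : MinTensor D D T) : Prop :=
  IsEmpty (D ≃⋆ₐ[ℂ] ℂ) ∧ ∃ φ : D ≃⋆ₐ[ℂ] T, ApproxUnitaryEquiv (⇑φ) h.fst

/-- The image of `u` under the upper-left-corner stabilization `u ↦ diag(u, 1, …, 1)`
into `M_{n+1}(A)`. -/
def stabUnitary {A : Type u} [CStarAlgebra A] (n : ℕ) (u : A) :
    Matrix (Fin (n + 1)) (Fin (n + 1)) A :=
  Matrix.diagonal (fun i => if i = 0 then u else 1)

/-- A unitary `u` represents `0` in `K₁(A)`: some matrix stabilization `diag(u, 1, …, 1)`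
is connected to the identity through the unitary group of a matrix algebra over `A`. -/
def RepresentsZeroInK1 {A : Type u} [CStarAlgebra A] (u : A) : Prop :=
  ∃ n : ℕ, ∃ h : stabUnitary n u ∈ unitary (Matrix (Fin (n + 1)) (Fin (n + 1)) A),
    Joined (⟨stabUnitary n u, h⟩ : ↥(unitary (Matrix (Fin (n + 1)) (Fin (n + 1)) A))) 1

/-- A unital C*-algebra is `K₁`-injective if the canonical map `U(A)/U₀(A) → K₁(A)` is
injective, i.e. every unitary representing `0` in `K₁(A)` lies in the connected component
of the unit of `U(A)`. -/
def K1Injective (A : Type u) [CStarAlgebra A] : Prop :=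
  ∀ u : ↥(unitary A), RepresentsZeroInK1 (u : A) → Joined u 1

section ApproximateInnerEquivalence

variable {A : Type*} {B : Type*} {C : Type*} {E : Type*}

/-- Approximate unitary equivalence of two maps into a unital C*-algebra, witnessed by a sequence
of unitaries in the algebra itself. -/
def ApproxInnerEquiv [CStarAlgebra B] (φ ψ : A → B) : Prop :=
  ∃ v : ℕ → unitary B, ∀ a, Tendsto (fun n => star (v n : B) * φ a * v n) atTop (𝓝 (ψ a))

lemma DoubleCentralizer.coe_fst_one [CStarAlgebra B] (v : 𝓜(ℂ, B)) :
    ((v.fst 1 : B) : 𝓜(ℂ, B)) = v := by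
  have hc : v.snd 1 = v.fst 1 := by simpa using v.central 1 1
  ext x
  · have := v.central 1 x
    simpa [hc] using this
  · have := v.central x 1
    simpa using this.symm

lemma DoubleCentralizer.norm_coe [CStarAlgebra B] (b : B) : ‖(b : 𝓜(ℂ, B))‖ = ‖b‖ := by
  have hinj : Function.Injective (DoubleCentralizer.coeHom (𝕜 := ℂ) (A := B)) := by
    intro x y hxy
    have := congrArg (fun z : 𝓜(ℂ, B) => z.fst 1) hxy
    simpa [DoubleCentralizer.coeHom] using this
  exact NonUnitalStarAlgHom.norm_map (DoubleCentralizer.coeHom (𝕜 := ℂ) (A := B)) hinj b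

lemma ApproxUnitaryEquiv.approxInnerEquiv [CStarAlgebra B] {φ ψ : A → B}
    (h : ApproxUnitaryEquiv φ ψ) : ApproxInnerEquiv φ ψ := by
  obtain ⟨v, hv, hlim⟩ := h
  let ι : B →⋆ₙₐ[ℂ] 𝓜(ℂ, B) := DoubleCentralizer.coeHom
  have hι (b : B) : ι b = (b : 𝓜(ℂ, B)) := rfl
  have hinj : Function.Injective ι := by
    intro x y hxy
    rw [← sub_eq_zero, ← norm_eq_zero, ← DoubleCentralizer.norm_coe, ← hι, map_sub, hxy,
      sub_self, norm_zero]
  have hone : ι 1 = 1 := by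
    rw [hι, ← DoubleCentralizer.coe_fst_one 1]
    simp
  have hu (n : ℕ) : ι ((v n).fst 1) = v n := DoubleCentralizer.coe_fst_one _
  refine ⟨fun n => ⟨(v n).fst 1, ?_⟩, fun a => ?_⟩
  · rw [Unitary.mem_iff]
    constructor
    · apply hinj
      rw [map_mul, map_star, hu, hone, (Unitary.mem_iff.1 (hv n)).1]
    · apply hinj
      rw [map_mul, map_star, hu, hone, (Unitary.mem_iff.1 (hv n)).2]
  · rw [tendsto_iff_norm_sub_tendsto_zero]
    refine (hlim a).congr fun n => ?_
    rw [← NonUnitalStarAlgHom.norm_map ι hinj, map_sub, map_mul, map_mul, map_star, hu]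
    rfl

lemma StarAlgHom.continuous_of_cstarAlgebra [CStarAlgebra B] [CStarAlgebra C] (π : B →⋆ₐ[ℂ] C) :
    Continuous π :=
  (NonUnitalStarAlgHom.instContinuousLinearMapClassComplex (F := B →⋆ₐ[ℂ] C)).map_continuous π

lemma Unitary.norm_star_mul_mul [CStarAlgebra B] (u : unitary B) (x : B) :
    ‖star (u : B) * x * u‖ = ‖x‖ := by
  rw [CStarRing.norm_mul_coe_unitary, CStarRing.norm_mem_unitary_mul _ (Unitary.star_mem u.2)]

lemma Unitary.tendsto_mul_mul_star [CStarAlgebra B] {v : ℕ → unitary B} {a b : B}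
    (h : Tendsto (fun n => star (v n : B) * a * v n) atTop (𝓝 b)) :
    Tendsto (fun n => v n * b * star (v n : B)) atTop (𝓝 a) := by
  rw [tendsto_iff_norm_sub_tendsto_zero]
  refine (tendsto_iff_norm_sub_tendsto_zero.1 h).congr fun n => ?_
  have key : star (v n : B) * a * v n - b
      = star (v n : B) * (a - v n * b * star (v n : B)) * v n := by
    have h1 : star (v n : B) * v n = 1 := Unitary.coe_star_mul_self _
    calc _ = star (v n : B) * a * v n - star (v n : B) * v n * b * (star (v n : B) * v n) := by
          rw [h1, one_mul, mul_one]
      _ = _ := by noncomm_ring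
  rw [key, Unitary.norm_star_mul_mul, norm_sub_rev]

namespace ApproxInnerEquiv

lemma trans [CStarAlgebra B] {φ ψ χ : A → B} (h : ApproxInnerEquiv φ ψ)
    (h' : ApproxInnerEquiv ψ χ) : ApproxInnerEquiv φ χ := by
  obtain ⟨v, hv⟩ := h
  obtain ⟨w, hw⟩ := h'
  refine ⟨fun n => v n * w n, fun a => ?_⟩
  have hz : Tendsto (fun n => star (w n : B) * (star (v n : B) * φ a * v n - ψ a) * w n)
      atTop (𝓝 0) := by
    rw [tendsto_zero_iff_norm_tendsto_zero]
    simp only [Unitary.norm_star_mul_mul]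
    exact tendsto_iff_norm_sub_tendsto_zero.1 (hv a)
  have := hz.add (hw a)
  rw [zero_add] at this
  refine this.congr fun n => ?_
  simp only [Submonoid.coe_mul, star_mul]
  noncomm_ring

lemma symm [CStarAlgebra B] {φ ψ : A → B} (h : ApproxInnerEquiv φ ψ) :
    ApproxInnerEquiv ψ φ := by
  obtain ⟨v, hv⟩ := h
  exact ⟨fun n => star (v n), fun a => by simpa using Unitary.tendsto_mul_mul_star (hv a)⟩

lemma map [CStarAlgebra B] [CStarAlgebra C] {φ ψ : A → B} (h : ApproxInnerEquiv φ ψ)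
    (π : B →⋆ₐ[ℂ] C) : ApproxInnerEquiv (fun a => π (φ a)) (fun a => π (ψ a)) := by
  obtain ⟨v, hv⟩ := h
  refine ⟨fun n => ⟨π (v n), Unitary.map_mem π (v n).2⟩, fun a => ?_⟩
  refine (((StarAlgHom.continuous_of_cstarAlgebra π).tendsto _).comp (hv a)).congr fun n => ?_
  simp [map_mul, map_star]

lemma comp [CStarAlgebra B] {φ ψ : A → B} (h : ApproxInnerEquiv φ ψ) (f : E → A) :
    ApproxInnerEquiv (fun e => φ (f e)) (fun e => ψ (f e)) := by
  obtain ⟨v, hv⟩ := h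
  exact ⟨v, fun e => hv (f e)⟩

end ApproxInnerEquiv

end ApproximateInnerEquivalence

section PointwiseLimits

variable {A B : Type*} [CStarAlgebra A] [CStarAlgebra B]

lemma isClosed_setOf_exists_tendsto_starAlgHom (f : ℕ → A →⋆ₐ[ℂ] B) :
    IsClosed {a | ∃ b, Tendsto (fun n => f n a) atTop (𝓝 b)} := by
  refine isClosed_of_closure_subset fun a ha => ?_
  refine cauchySeq_tendsto_of_complete (Metric.cauchySeq_iff.2 fun ε hε => ?_)
  obtain ⟨a', ⟨b, hb⟩, hd⟩ := Metric.mem_closure_iff.1 ha (ε / 3) (by positivity)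
  obtain ⟨N, hN⟩ := Metric.cauchySeq_iff.1 hb.cauchySeq (ε / 3) (by positivity)
  have hle (n : ℕ) : dist (f n a) (f n a') < ε / 3 := by
    rw [dist_eq_norm, ← map_sub]
    exact (NonUnitalStarAlgHom.norm_apply_le (f n) _).trans_lt (by rwa [← dist_eq_norm])
  refine ⟨N, fun m hm n hn => ?_⟩
  have := dist_triangle4 (f m a) (f m a') (f n a') (f n a)
  have h1 := hle m
  have h2 := hle n
  rw [dist_comm] at h2
  have h3 := hN m hm n hn
  linarith

lemma isClosed_setOf_tendsto_starAlgHom (f : ℕ → A →⋆ₐ[ℂ] B) (g : A →⋆ₐ[ℂ] B) :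
    IsClosed {a | Tendsto (fun n => f n a) atTop (𝓝 (g a))} := by
  refine Equicontinuous.isClosed_setOfPred_tendsto (UniformEquicontinuous.equicontinuous
    (LipschitzWith.uniformEquicontinuous _ 1 fun n => LipschitzWith.of_dist_le_mul fun a b => ?_))
    (StarAlgHom.continuous_of_cstarAlgebra g)
  rw [dist_eq_norm, dist_eq_norm, ← map_sub, NNReal.coe_one, one_mul]
  exact NonUnitalStarAlgHom.norm_apply_le (f n) _

/-- The pointwise limit of a sequence of unital `⋆`-homomorphisms. -/
lemma exists_starAlgHom_tendsto (f : ℕ → A →⋆ₐ[ℂ] B)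
    (hf : ∀ a, ∃ b, Tendsto (fun n => f n a) atTop (𝓝 b)) :
    ∃ F : A →⋆ₐ[ℂ] B, ∀ a, Tendsto (fun n => f n a) atTop (𝓝 (F a)) := by
  choose F hF using hf
  have huniq {a : A} {b : B} (h : Tendsto (fun n => f n a) atTop (𝓝 b)) : F a = b :=
    tendsto_nhds_unique (hF a) h
  refine ⟨{ toFun := F, map_one' := ?_, map_mul' := ?_, map_zero' := ?_, map_add' := ?_,
            commutes' := ?_, map_star' := ?_ }, hF⟩
  · exact huniq (by simp)
  · exact fun x y => huniq (by simpa using (hF x).mul (hF y))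
  · exact huniq (by simp)
  · exact fun x y => huniq (by simpa using (hF x).add (hF y))
  · exact fun c => huniq (by simp [AlgHomClass.commutes])
  · exact fun x => huniq (by simpa [map_star] using (hF x).star)

end PointwiseLimits

section Commutators

variable {A : Type*} [CStarAlgebra A]

/-- The path of unitaries `R(t) diag(w, 1) R(t)*`, with `R(t)` the rotation by the angle `t`. -/
def rotatedStab (w : A) (t : ℝ) : Matrix (Fin (1 + 1)) (Fin (1 + 1)) A :=
  !![((Real.cos t : ℂ) ^ 2) • w + ((Real.sin t : ℂ) ^ 2) • 1,
      ((Real.cos t : ℂ) * (Real.sin t : ℂ)) • (w - 1);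
    ((Real.cos t : ℂ) * (Real.sin t : ℂ)) • (w - 1),
      ((Real.sin t : ℂ) ^ 2) • w + ((Real.cos t : ℂ) ^ 2) • 1]

lemma star_rotatedStab (w : A) (t : ℝ) : star (rotatedStab w t) = rotatedStab (star w) t := by
  ext i j
  fin_cases i <;> fin_cases j <;>
    simp [rotatedStab, Matrix.star_apply, Complex.conj_ofReal, -Complex.ofReal_cos,
      -Complex.ofReal_sin]

lemma rotatedStab_mul (w z : A) (t : ℝ) :
    rotatedStab w t * rotatedStab z t = rotatedStab (w * z) t := by
  have hcs : (Real.sin t : ℂ) ^ 2 = 1 - (Real.cos t : ℂ) ^ 2 := by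
    exact_mod_cast Real.sin_sq t
  ext i j
  fin_cases i <;> fin_cases j <;>
    simp only [rotatedStab, Matrix.mul_apply, Fin.sum_univ_two, Matrix.of_apply,
      Matrix.cons_val', Matrix.cons_val_zero, Matrix.cons_val_one, Fin.zero_eta, Fin.mk_one,
      Matrix.cons_val_fin_one, mul_add, add_mul, mul_sub, sub_mul, mul_one,
      one_mul, smul_sub, smul_mul_assoc, mul_smul_comm, smul_smul] <;>
    generalize (Real.sin t : ℂ) = s at * <;>
    generalize (Real.cos t : ℂ) = c at * <;>
    match_scalars <;> grind

lemma rotatedStab_one (t : ℝ) : rotatedStab (1 : A) t = 1 := by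
  have h : (Real.cos t : ℂ) ^ 2 + (Real.sin t : ℂ) ^ 2 = 1 := by
    exact_mod_cast Real.cos_sq_add_sin_sq t
  have h' : (Real.sin t : ℂ) ^ 2 + (Real.cos t : ℂ) ^ 2 = 1 := by rw [add_comm, h]
  ext i j
  fin_cases i <;> fin_cases j <;>
    simp [rotatedStab, ← add_smul, h, h', -Complex.ofReal_cos, -Complex.ofReal_sin]

lemma rotatedStab_zero (w : A) : rotatedStab w 0 = stabUnitary 1 w := by
  ext i j
  fin_cases i <;> fin_cases j <;> simp [rotatedStab, stabUnitary]

lemma rotatedStab_pi_div_two (w : A) :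
    rotatedStab w (Real.pi / 2) = Matrix.diagonal ![1, w] := by
  ext i j
  fin_cases i <;> fin_cases j <;> simp [rotatedStab]

lemma rotatedStab_mem_unitary {w : A} (hw : w ∈ unitary A) (t : ℝ) :
    rotatedStab w t ∈ unitary (Matrix (Fin (1 + 1)) (Fin (1 + 1)) A) := by
  rw [Unitary.mem_iff, star_rotatedStab, rotatedStab_mul, rotatedStab_mul,
    (Unitary.mem_iff.1 hw).1, (Unitary.mem_iff.1 hw).2]
  exact ⟨rotatedStab_one t, rotatedStab_one t⟩

lemma continuous_rotatedStab (w : A) : Continuous (rotatedStab w) := by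
  refine continuous_matrix fun i j => ?_
  fin_cases i <;> fin_cases j <;> simp only [rotatedStab, Fin.zero_eta, Fin.mk_one,
    Matrix.of_apply, Matrix.cons_val', Matrix.cons_val_zero, Matrix.cons_val_one,
    Matrix.cons_val_fin_one] <;> fun_prop

/-- Commutators of unitaries vanish in `K₁`. -/
lemma representsZeroInK1_commutator {u w : A} (hu : u ∈ unitary A) (hw : w ∈ unitary A) :
    RepresentsZeroInK1 (u * w * star u * star w) := by
  let M := Matrix (Fin (1 + 1)) (Fin (1 + 1)) A
  let U : unitary M := ⟨rotatedStab u 0, rotatedStab_mem_unitary hu 0⟩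
  let W : ℝ → unitary M := fun t => ⟨rotatedStab w t, rotatedStab_mem_unitary hw t⟩
  have hW : Continuous W := (continuous_rotatedStab w).subtype_mk _
  have h0 : ((U * W 0 * star U * star (W 0) : unitary M) : M)
      = stabUnitary 1 (u * w * star u * star w) := by
    change rotatedStab u 0 * rotatedStab w 0 * star (rotatedStab u 0) * star (rotatedStab w 0) = _
    rw [star_rotatedStab, star_rotatedStab, rotatedStab_mul, rotatedStab_mul, rotatedStab_mul,
      rotatedStab_zero]
  have h1 : U * W (Real.pi / 2) * star U * star (W (Real.pi / 2)) = 1 := by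
    have hcomm : U * W (Real.pi / 2) = W (Real.pi / 2) * U := by
      apply Subtype.ext
      change rotatedStab u 0 * rotatedStab w (Real.pi / 2)
        = rotatedStab w (Real.pi / 2) * rotatedStab u 0
      rw [rotatedStab_zero, rotatedStab_pi_div_two, stabUnitary, Matrix.diagonal_mul_diagonal,
        Matrix.diagonal_mul_diagonal]
      congr 1
      ext i
      fin_cases i <;> simp
    rw [hcomm, mul_assoc (W _), Unitary.mul_star_self, mul_one, Unitary.mul_star_self]
  have hj := (PathConnectedSpace.joined (0 : ℝ) (Real.pi / 2)).map
    (f := fun t => U * W t * star U * star (W t)) (by fun_prop)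
  rw [h1] at hj
  refine ⟨1, h0 ▸ (U * W 0 * star U * star (W 0)).2, ?_⟩
  convert hj using 1
  exact Subtype.ext h0.symm

end Commutators

section TensorProducts

variable {D : Type u} {T : Type u} [CStarAlgebra D] [CStarAlgebra T]

lemma CStarTensor.continuous_tmul (h : CStarTensor D D T) :
    Continuous fun p : D × D => h.tmul p.1 p.2 :=
  (LinearMap.mkContinuous₂
    (LinearMap.mk₂ ℂ h.tmul h.add_left h.smul_left h.add_right h.smul_right) 1
    fun a b => by simp [h.norm_tmul]).continuous₂

lemma CStarTensor.induction (h : CStarTensor D D T) {P : T → Prop} (hclosed : IsClosed {t | P t})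
    (hadd : ∀ s t, P s → P t → P (s + t)) (hsmul : ∀ (c : ℂ) t, P t → P (c • t))
    (htmul : ∀ a b, P (h.tmul a b)) (t : T) : P t := by
  have hsub : ((Submodule.span ℂ {t : T | ∃ a b, h.tmul a b = t} : Submodule ℂ T) : Set T)
      ⊆ {t | P t} := by
    intro s hs
    induction hs using Submodule.span_induction with
    | mem x hx => obtain ⟨a, b, rfl⟩ := hx; exact htmul a b
    | zero => simpa using hsmul 0 _ (htmul 0 0)
    | add x y _ _ hx hy => exact hadd x y hx hy
    | smul c x _ hx => exact hsmul c x hx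
  exact closure_minimal hsub hclosed (h.dense_span t)

lemma MinTensor.exists_starAlgHom (h : MinTensor D D T) (hu : h.tmul 1 1 = 1)
    (h' : CStarTensor D D T) (hu' : h'.tmul 1 1 = 1) :
    ∃ π : T →⋆ₐ[ℂ] T, ∀ a b, π (h'.tmul a b) = h.tmul a b := by
  obtain ⟨π, hπ⟩ := h.minimal T h'
  have h1 : π 1 = 1 := by simpa only [hu', hu] using hπ 1 1
  exact ⟨{ π with
    map_one' := h1
    commutes' := fun c => by
      change π (algebraMap ℂ T c) = algebraMap ℂ T c
      rw [Algebra.algebraMap_eq_smul_one, map_smul, h1] }, hπ⟩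

lemma MinTensor.exists_flip (h : MinTensor D D T) (hu : h.tmul 1 1 = 1) :
    ∃ σ : T →⋆ₐ[ℂ] T, ∀ a b, σ (h.tmul a b) = h.tmul b a := by
  obtain ⟨π, hπ⟩ := h.exists_starAlgHom hu
    { tmul := fun a b => h.tmul b a
      add_left := fun a a' b => h.add_right b a a'
      add_right := fun a b b' => h.add_left b b' a
      smul_left := fun c a b => h.smul_right c b a
      smul_right := fun c a b => h.smul_left c b a
      mul_tmul := fun a a' b b' => h.mul_tmul b b' a a'
      star_tmul := fun a b => h.star_tmul b a
      norm_tmul := fun a b => by rw [h.norm_tmul, mul_comm]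
      dense_span := by
        have hset : {t : T | ∃ a b, h.tmul b a = t} = {t : T | ∃ a b, h.tmul a b = t} :=
          Set.ext fun t => exists_comm
        rw [hset]
        exact h.dense_span } hu
  exact ⟨π, fun a b => hπ b a⟩

/-- An automorphism of the second tensor factor extends to the tensor product. -/
lemma MinTensor.exists_map_right (h : MinTensor D D T) (hu : h.tmul 1 1 = 1) (θ : D ≃⋆ₐ[ℂ] D) :
    ∃ π : T →⋆ₐ[ℂ] T, ∀ a b, π (h.tmul a b) = h.tmul a (θ b) := by
  obtain ⟨π, hπ⟩ := h.exists_starAlgHom hu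
    { tmul := fun a b => h.tmul a (θ.symm b)
      add_left := fun a a' b => h.add_left a a' _
      add_right := fun a b b' => by rw [map_add, h.add_right]
      smul_left := fun c a b => h.smul_left c a _
      smul_right := fun c a b => by rw [map_smul, h.smul_right]
      mul_tmul := fun a a' b b' => by rw [map_mul, h.mul_tmul]
      star_tmul := fun a b => by rw [map_star, h.star_tmul]
      norm_tmul := fun a b => by rw [h.norm_tmul, StarAlgEquiv.norm_map]
      dense_span := by
        have hset : {t : T | ∃ a b, h.tmul a (θ.symm b) = t} = {t : T | ∃ a b, h.tmul a b = t} :=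
          Set.ext fun t => exists_congr fun a =>
            ((EquivLike.surjective θ.symm).exists (p := fun b => h.tmul a b = t)).symm
        rw [hset]
        exact h.dense_span } (by
      change h.tmul 1 (θ.symm 1) = 1
      rw [map_one, hu])
  exact ⟨π, fun a b => by simpa using hπ a (θ b)⟩

/-- Approximately inner endomorphisms `f` admit a tensor square `f ⊗ f`, which is again
approximately inner. -/
lemma CStarTensor.exists_tensor_square (h : CStarTensor D D T) (hu : h.tmul 1 1 = 1) {f : D → D}
    (hf : ApproxInnerEquiv (fun a => a) f) :
    ∃ F : T →⋆ₐ[ℂ] T, (∀ a b, F (h.tmul a b) = h.tmul (f a) (f b)) ∧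
      ApproxInnerEquiv (fun t => t) F := by
  obtain ⟨w, hw⟩ := hf
  let W : ℕ → unitary T := fun n => ⟨h.tmul (w n) (w n), by
    rw [Unitary.mem_iff, h.star_tmul, h.mul_tmul, h.mul_tmul, (Unitary.mem_iff.1 (w n).2).1,
      (Unitary.mem_iff.1 (w n).2).2, hu]
    exact ⟨rfl, rfl⟩⟩
  let g : ℕ → T →⋆ₐ[ℂ] T := fun n => (Unitary.conjStarAlgAut ℂ T (star (W n))).toStarAlgHom
  have hg (n : ℕ) (t : T) : g n t = star (W n : T) * t * W n :=
    Unitary.conjStarAlgAut_star_apply (S := ℂ) _ _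
  have htmul (a b : D) : Tendsto (fun n => g n (h.tmul a b)) atTop (𝓝 (h.tmul (f a) (f b))) := by
    refine ((h.continuous_tmul.tendsto (f a, f b)).comp
      ((hw a).prodMk_nhds (hw b))).congr fun n => ?_
    simp only [hg, W, h.star_tmul, h.mul_tmul, Function.comp_apply]
  obtain ⟨F, hF⟩ := exists_starAlgHom_tendsto g (h.induction
    (isClosed_setOf_exists_tendsto_starAlgHom g)
    (fun s t ⟨x, hx⟩ ⟨y, hy⟩ => ⟨x + y, by simpa using hx.add hy⟩)
    (fun c t ⟨x, hx⟩ => ⟨c • x, by simpa using hx.const_smul c⟩)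
    (fun a b => ⟨_, htmul a b⟩))
  exact ⟨F, fun a b => tendsto_nhds_unique (hF _) (htmul a b), W, fun t => by
    simpa only [hg] using hF t⟩

lemma tendsto_star_mul_mul_of_sub_tendsto_zero {x y : ℕ → unitary T} {m l : T}
    (hxy : Tendsto (fun k => (x k : T) - y k) atTop (𝓝 0))
    (hy : Tendsto (fun k => star (y k : T) * m * y k) atTop (𝓝 l)) :
    Tendsto (fun k => star (x k : T) * m * x k) atTop (𝓝 l) := by
  have hz : Tendsto (fun k => star (x k : T) * m * x k - star (y k : T) * m * y k)
      atTop (𝓝 0) := by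
    refine squeeze_zero_norm (a := fun k => 2 * ‖m‖ * ‖(x k : T) - y k‖) (fun k => ?_) ?_
    · have hsplit : star (x k : T) * m * x k - star (y k : T) * m * y k
          = star ((x k : T) - y k) * m * x k + star (y k : T) * (m * ((x k : T) - y k)) := by
        rw [star_sub]
        noncomm_ring
      rw [hsplit]
      refine (norm_add_le _ _).trans ?_
      rw [CStarRing.norm_mul_coe_unitary,
        CStarRing.norm_mem_unitary_mul _ (Unitary.star_mem (y k).2)]
      have h1 := norm_mul_le (star ((x k : T) - y k)) m
      have h2 := norm_mul_le m ((x k : T) - y k)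
      rw [norm_star] at h1
      linarith
    · simpa using (tendsto_zero_iff_norm_tendsto_zero.1 hxy).const_mul (2 * ‖m‖)
  simpa using hz.add hy

/-- The flip on a strongly self-absorbing C*-algebra is approximately implemented by commutators
of unitaries. -/
theorem IsStronglySelfAbsorbing.exists_commutator_flip {h : MinTensor D D T}
    (hu : h.tmul 1 1 = 1) (hssa : IsStronglySelfAbsorbing h) :
    ∃ p y : ℕ → unitary T, ∀ a b, Tendsto
      (fun k => star ((p k * y k * star (p k) * star (y k) : unitary T) : T) * h.tmul a b *
        (p k * y k * star (p k) * star (y k) : unitary T)) atTop (𝓝 (h.tmul b a)) := by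
  obtain ⟨-, φ, hφ⟩ := hssa
  replace hφ : ApproxInnerEquiv (fun a => φ a) (fun a => h.tmul a 1) := hφ.approxInnerEquiv
  obtain ⟨σ, hσ⟩ := h.exists_flip hu
  have hσc := StarAlgHom.continuous_of_cstarAlgebra σ
  have hσσ : Function.Involutive σ := h.induction (isClosed_eq (hσc.comp hσc) continuous_id)
    (fun s t hs ht => by rw [map_add, map_add, hs, ht])
    (fun c t ht => by rw [map_smul, map_smul, ht]) (fun a b => by rw [hσ, hσ])
  let θ : D ≃⋆ₐ[ℂ] D :=
    (φ.trans (StarAlgEquiv.ofBijective σ hσσ.bijective)).trans φ.symm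
  have hφθ (a : D) : φ (θ a) = σ (φ a) := by simp [θ]
  have hflip : ApproxInnerEquiv (fun a => σ (φ a)) (fun a => h.tmul 1 a) := by
    simpa only [hσ] using hφ.map σ
  have hθ : ApproxInnerEquiv (fun a => h.tmul (θ a) 1) (fun a => h.tmul 1 a) := by
    have := (hφ.comp θ).symm
    simp only [hφθ] at this
    exact this.trans hflip
  obtain ⟨Θ, hΘ⟩ := h.exists_map_right hu θ
  have hhalf : ApproxInnerEquiv (fun a => h.tmul a 1) (fun a => h.tmul 1 a) := by
    simpa [hΘ] using (hθ.map Θ).comp θ.symm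
  obtain ⟨v, hv⟩ : ApproxInnerEquiv σ (fun t => t) := by
    simpa using (hflip.trans (hhalf.symm.trans hφ.symm)).comp φ.symm
  have hv' (t : T) : Tendsto (fun n => star (v n : T) * t * v n) atTop (𝓝 (σ t)) := by
    simpa only [hσσ t] using hv (σ t)
  have hv'' (t : T) : Tendsto (fun n => v n * t * star (v n : T)) atTop (𝓝 (σ t)) :=
    Unitary.tendsto_mul_mul_star (hv t)
  have hι : ApproxInnerEquiv (fun a => a) (fun a => φ.symm (h.tmul a 1)) := by
    simpa using hφ.map φ.symm.toStarAlgHom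
  have hκ : ApproxInnerEquiv (fun a => a) (fun a => φ.symm (h.tmul 1 a)) := by
    simpa using (hφ.trans hhalf).map φ.symm.toStarAlgHom
  obtain ⟨J, hJ, hJinner⟩ := h.exists_tensor_square hu hι
  obtain ⟨K, hK, hKinner⟩ := h.exists_tensor_square hu hκ
  have hJc := StarAlgHom.continuous_of_cstarAlgebra J
  have hKc := StarAlgHom.continuous_of_cstarAlgebra K
  have hcomm (s t : T) : J s * K t = K t * J s := by
    refine h.induction (P := fun s => J s * K t = K t * J s)
      (isClosed_eq (by fun_prop) (by fun_prop))
      (fun s s' hs hs' => by rw [map_add, add_mul, mul_add, hs, hs'])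
      (fun c s hs => by rw [map_smul, smul_mul_assoc, mul_smul_comm, hs]) (fun a b => ?_) s
    refine h.induction (P := fun t => J (h.tmul a b) * K t = K t * J (h.tmul a b))
      (isClosed_eq (by fun_prop) (by fun_prop))
      (fun s s' hs hs' => by rw [map_add, add_mul, mul_add, hs, hs'])
      (fun c s hs => by rw [map_smul, smul_mul_assoc, mul_smul_comm, hs]) (fun c d => ?_) t
    simp only [hJ, hK, h.mul_tmul, ← map_mul, mul_one, one_mul]
  have hJK (a b c d : D) : J (h.tmul a b) * K (h.tmul c d)
      = h.tmul (φ.symm (h.tmul a c)) (φ.symm (h.tmul b d)) := by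
    simp only [hJ, hK, h.mul_tmul, ← map_mul, mul_one, one_mul]
  obtain ⟨y, hy⟩ := hJinner.symm.trans hKinner
  have hn (k : ℕ) : ∃ n, ‖star (y n : T) * J (star (v k : T)) * y n - K (star (v k : T))‖
      < 1 / ((k : ℝ) + 1) :=
    (((tendsto_iff_norm_sub_tendsto_zero.1 (hy (star (v k : T)))).eventually_lt_const
      (Nat.one_div_pos_of_nat)).exists)
  choose n hn using hn
  let p : ℕ → unitary T := fun k => ⟨J (v k), Unitary.map_mem J (v k).2⟩
  let q : ℕ → unitary T := fun k => ⟨K (v k), Unitary.map_mem K (v k).2⟩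
  let x : ℕ → unitary T := fun k => p k * star (y (n k)) * star (p k) * star (star (y (n k)))
  have hxq : Tendsto (fun k => (x k : T) - (p k * star (q k) : unitary T)) atTop (𝓝 0) := by
    refine squeeze_zero_norm (fun k => ?_) tendsto_one_div_add_atTop_nhds_zero_nat
    have hfac : (x k : T) - (p k * star (q k) : unitary T)
        = p k * (star (y (n k) : T) * J (star (v k : T)) * y (n k) - K (star (v k : T))) := by
      simp only [x, p, q, Submonoid.coe_mul, Unitary.coe_star, star_star, map_star]
      noncomm_ring
    rw [hfac, CStarRing.norm_coe_unitary_mul]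
    exact (hn k).le
  have hlim (s t : T) : Tendsto (fun k => star (x k : T) * (J s * K t) * x k) atTop
      (𝓝 (J (σ s) * K (σ t))) := by
    refine tendsto_star_mul_mul_of_sub_tendsto_zero hxq ?_
    refine (((hJc.tendsto _).comp (hv' s)).mul ((hKc.tendsto _).comp (hv'' t))).congr fun k => ?_
    simp only [Function.comp_apply, p, q, Submonoid.coe_mul, Unitary.coe_star, star_mul, star_star]
    calc J (star (v k : T) * s * v k) * K (v k * t * star (v k : T))
        = J (star (v k : T) * s * v k) * K (v k) * K t * K (star (v k : T)) := by
          simp only [map_mul, mul_assoc]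
      _ = K (v k) * J (star (v k : T)) * J s * (J (v k) * K t) * K (star (v k : T)) := by
          rw [hcomm]
          simp only [map_mul, mul_assoc]
      _ = _ := by
          rw [hcomm (v k) t, map_star, map_star]
          simp only [mul_assoc]
  refine ⟨p, fun k => star (y (n k)), fun a b => ?_⟩
  let g : ℕ → T →⋆ₐ[ℂ] T := fun n => (Unitary.conjStarAlgAut ℂ T (star (x n))).toStarAlgHom
  have hg (n : ℕ) (t : T) : g n t = star (x n : T) * t * x n :=
    Unitary.conjStarAlgAut_star_apply (S := ℂ) _ _
  let S : T → Prop := fun t => Tendsto (fun n => g n t) atTop (𝓝 (σ t))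
  have hS : IsClosed {t | S t} := isClosed_setOf_tendsto_starAlgHom g σ
  have hSadd (s t : T) (hs : S s) (ht : S t) : S (s + t) := by
    simpa [S] using hs.add ht
  have hSsmul (c : ℂ) (t : T) (ht : S t) : S (c • t) := by
    simpa [S] using ht.const_smul c
  have hφc := StarAlgHom.continuous_of_cstarAlgebra φ.symm.toStarAlgHom
  have hS' (s t : T) : S (h.tmul (φ.symm s) (φ.symm t)) := by
    refine h.induction (P := fun s => S (h.tmul (φ.symm s) (φ.symm t)))
      (hS.preimage (h.continuous_tmul.comp (hφc.prodMk continuous_const)))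
      (fun s s' hs hs' => by rw [map_add, h.add_left]; exact hSadd _ _ hs hs')
      (fun c s hs => by rw [map_smul, h.smul_left]; exact hSsmul _ _ hs) (fun a c => ?_) s
    refine h.induction (P := fun t => S (h.tmul (φ.symm (h.tmul a c)) (φ.symm t)))
      (hS.preimage (h.continuous_tmul.comp (continuous_const.prodMk hφc)))
      (fun s s' hs hs' => by rw [map_add, h.add_right]; exact hSadd _ _ hs hs')
      (fun c s hs => by rw [map_smul, h.smul_right]; exact hSsmul _ _ hs) (fun b d => ?_) t
    have := hlim (h.tmul a b) (h.tmul c d)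
    rw [hσ, hσ, hJK, hJK] at this
    simpa only [S, hg, hσ] using this
  have := hS' (φ a) (φ b)
  simp only [S, hg, hσ, φ.symm_apply_apply] at this
  exact this

end TensorProducts

/-- For `D` separable, unital and strongly self-absorbing, the unitaries implementing the
approximately inner flip on `D ⊗ D` may be chosen to represent `0` in `K₁(D ⊗ D)`; if `D`
(equivalently `D ⊗ D`) is `K₁`-injective, they may be chosen homotopic to the unit. -/
theorem stmt_8 {D : Type u} {T : Type u} [CStarAlgebra D] [CStarAlgebra T]
    [TopologicalSpace.SeparableSpace D]
    (h : MinTensor D D T) (hu : h.tmul 1 1 = 1)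
    (hssa : IsStronglySelfAbsorbing h) :
    (∃ v : ℕ → T, (∀ k, v k ∈ unitary T) ∧ (∀ k, RepresentsZeroInK1 (v k)) ∧
      ∀ a b : D, Tendsto
        (fun k => ‖star (v k) * h.tmul a b * v k - h.tmul b a‖) atTop (𝓝 (0 : ℝ))) ∧
    (K1Injective D →
      ∃ v : ℕ → T, (∀ k, ∃ hk : v k ∈ unitary T, Joined (⟨v k, hk⟩ : ↥(unitary T)) 1) ∧
        ∀ a b : D, Tendsto
          (fun k => ‖star (v k) * h.tmul a b * v k - h.tmul b a‖) atTop (𝓝 (0 : ℝ))) := by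
  obtain ⟨p, y, hpy⟩ := hssa.exists_commutator_flip hu
  have hlim (a b : D) := tendsto_iff_norm_sub_tendsto_zero.1 (hpy a b)
  refine ⟨⟨_, fun k => (p k * y k * star (p k) * star (y k)).2,
    fun k => representsZeroInK1_commutator (p k).2 (y k).2, hlim⟩, fun hK => ⟨_, fun k =>
    ⟨(p k * y k * star (p k) * star (y k)).2, ?_⟩, hlim⟩⟩
  obtain ⟨-, φ, -⟩ := hssa
  let Φ : unitary D → unitary T := fun u => ⟨φ u, Unitary.map_mem φ u.2⟩
  have hΦ : Continuous Φ :=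
    ((StarAlgHom.continuous_of_cstarAlgebra φ.toStarAlgHom).comp
      continuous_subtype_val).subtype_mk _
  let p' : unitary D := ⟨φ.symm (p k), Unitary.map_mem φ.symm (p k).2⟩
  let y' : unitary D := ⟨φ.symm (y k), Unitary.map_mem φ.symm (y k).2⟩
  have hj := (hK (p' * y' * star p' * star y')
    (representsZeroInK1_commutator p'.2 y'.2)).map hΦ
  have hc : Φ (p' * y' * star p' * star y') = p k * y k * star (p k) * star (y k) :=
    Subtype.ext (by simp [Φ, p', y', map_star])
  have h1 : Φ 1 = 1 := Subtype.ext (by simp [Φ])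
  rwa [hc, h1] at hj
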